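/- arXiv:1811.01230 — 3 statements merged into one kernel-verified Lean document; each statement's English description precedes it below -/
import Mathlib

section
/- Let R be a commutative unital ring, a ∈ R, and suppose (a·f(x), a·g(x), h(x)) is a unimodular row over R[x]. Then (a·f(x), a·g(x), h(x)) is equivalent under E₃(R[x]) to (f(x), g(x), h(x)). In particular (f(x), g(x), h(x)) is also unimodular. -/
open Matrix Polynomial

/-- The set of elementary matrices (transvections) over a commutative ring. -/
def ElemSet (ι R : Type) [Fintype ι] [DecidableEq ι] [CommRing R] :
    Set (Matrix ι ι R) :=
  { M | ∃ i j : ι, ∃ a : R, i ≠ j ∧ M = Matrix.transvection i j a }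

/-- The elementary subgroup `E_n(R)`, as the multiplicative closure of the
elementary matrices (it is closed under inverses, hence a group). -/
def Elem (ι R : Type) [Fintype ι] [DecidableEq ι] [CommRing R] :
    Submonoid (Matrix ι ι R) :=
  Submonoid.closure (ElemSet ι R)

/-- A row is unimodular if its entries generate the unit ideal. -/
def IsUnimodular {ι R : Type} [CommRing R] (v : ι → R) : Prop :=
  Ideal.span (Set.range v) = ⊤

/-- Two rows are equivalent under the elementary group if one is obtained from
the other by right multiplication by an element of `E_n(R)`. -/
def RowEquivE {ι R : Type} [Fintype ι] [DecidableEq ι] [CommRing R]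
    (v w : ι → R) : Prop :=
  ∃ E ∈ Elem ι R, Matrix.vecMul v E = w

theorem RowEquivE.trans {ι A : Type} [Fintype ι] [DecidableEq ι] [CommRing A]
    {u v w : ι → A} (huv : RowEquivE u v) (hvw : RowEquivE v w) : RowEquivE u w := by
  obtain ⟨E, hE, rfl⟩ := huv
  obtain ⟨F, hF, rfl⟩ := hvw
  exact ⟨E * F, mul_mem hE hF, (Matrix.vecMul_vecMul _ _ _).symm⟩

theorem rowEquivE_transvection {ι A : Type} [Fintype ι] [DecidableEq ι] [CommRing A]
    (v : ι → A) {i j : ι} (hij : i ≠ j) (c : A) :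
    RowEquivE v (Matrix.vecMul v (Matrix.transvection i j c)) :=
  ⟨_, Submonoid.subset_closure ⟨i, j, c, hij, rfl⟩, rfl⟩

/-- Multiples of the last entry may be added to the first two entries. -/
theorem rowEquivE_add_mul_last {A : Type} [CommRing A] (f g h c d : A) :
    RowEquivE ![f, g, h] ![f + h * c, g + h * d, h] := by
  refine (rowEquivE_transvection _ (show (2 : Fin 3) ≠ 0 by decide) c).trans ?_
  convert rowEquivE_transvection _ (show (2 : Fin 3) ≠ 1 by decide) d using 1
  ext k
  fin_cases k <;>
    simp [Matrix.transvection, Matrix.vecMul, dotProduct, Fin.sum_univ_three,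
      Matrix.single_apply]

/-- Multiples of the first two entries may be added to the last entry. -/
theorem rowEquivE_last_add {A : Type} [CommRing A] (f g h c d : A) :
    RowEquivE ![f, g, h] ![f, g, h + f * c + g * d] := by
  refine (rowEquivE_transvection _ (show (0 : Fin 3) ≠ 2 by decide) c).trans ?_
  convert rowEquivE_transvection _ (show (1 : Fin 3) ≠ 2 by decide) d using 1
  ext k
  fin_cases k <;>
    simp [Matrix.transvection, Matrix.vecMul, dotProduct, Fin.sum_univ_three,
      Matrix.single_apply]
  ring

/-- If `(p, q, r)` is a section of the row `(f, g, h)`, then adding to the row a multiple of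
`(-q, p, 0)`, which is orthogonal to `(p, q, r)`, is an elementary operation. -/
theorem rowEquivE_add_orthogonal {A : Type} [CommRing A] {f g h p q r : A}
    (hpqr : f * p + g * q + h * r = 1) (c : A) :
    RowEquivE ![f, g, h] ![f - c * q, g + c * p, h] := by
  have key := (((rowEquivE_add_mul_last f g h (-(c * r * q)) (c * r * p)).trans
    (rowEquivE_last_add _ _ _ p q)).trans
    (rowEquivE_add_mul_last _ _ _ (-(c * q)) (c * p))).trans
    (rowEquivE_last_add _ _ _ (-p) (-q))
  refine (key.trans (rowEquivE_add_mul_last _ _ _ (c * q) (-(c * p)))).trans ?_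
  convert rowEquivE_add_mul_last (f - c * q) (g + c * p) h 0 0 using 1
  · ext k
    fin_cases k
    · simp only [Fin.zero_eta, Matrix.cons_val_zero]
      linear_combination (-c * q) * hpqr
    · simp only [Fin.mk_one, Matrix.cons_val_one, Matrix.cons_val_zero]
      linear_combination (c * p) * hpqr
    · simp only [Fin.reduceFinMk, Matrix.cons_val]
      ring
  · simp

theorem isUnimodular_fin_three_iff {A : Type} [CommRing A] {f g h : A} :
    IsUnimodular ![f, g, h] ↔ ∃ p q r, f * p + g * q + h * r = 1 := by
  rw [IsUnimodular, Ideal.eq_top_iff_one, Ideal.mem_span_range_iff_exists_fun]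
  constructor
  · rintro ⟨c, hc⟩
    refine ⟨c 0, c 1, c 2, ?_⟩
    simpa [Fin.sum_univ_three, mul_comm] using hc
  · rintro ⟨p, q, r, hpqr⟩
    exact ⟨![p, q, r], by simpa [Fin.sum_univ_three, mul_comm] using hpqr⟩

/-- Over any commutative ring, a common factor of the first two entries of a unimodular row of
length three can be removed by elementary operations. -/
theorem rowEquivE_of_mul_left {A : Type} [CommRing A] {a f g h p q r : A}
    (hpqr : a * f * p + a * g * q + h * r = 1) :
    RowEquivE ![a * f, a * g, h] ![f, g, h] := by
  have h₁ := rowEquivE_add_orthogonal hpqr 1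
  have h₂ : (a * f - 1 * q) * (p + (a - 1) * (a * g + p)) +
      (a * g + 1 * p) * (q - (a - 1) * (a * f - q)) + h * r = 1 := by
    linear_combination hpqr
  have h₃ := h₁.trans (rowEquivE_add_orthogonal h₂ (-(f * p + g * q)))
  convert h₃.trans (rowEquivE_add_mul_last _ _ _ (r * (f - a * f + q)) (r * (g - a * g - p)))
    using 1
  ext k
  fin_cases k
  · simp only [Fin.zero_eta, Matrix.cons_val_zero]
    linear_combination (a * f - f - q) * hpqr
  · simp only [Fin.mk_one, Matrix.cons_val_one, Matrix.cons_val_zero]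
    linear_combination (a * g - g + p) * hpqr
  · rfl

theorem stmt_3 {R : Type} [CommRing R] (a : R) (f g h : R[X])
    (hum : IsUnimodular ![C a * f, C a * g, h]) :
    RowEquivE ![C a * f, C a * g, h] ![f, g, h] ∧ IsUnimodular ![f, g, h] := by
  obtain ⟨p, q, r, hpqr⟩ := isUnimodular_fin_three_iff.1 hum
  exact ⟨rowEquivE_of_mul_left hpqr, isUnimodular_fin_three_iff.2
    ⟨C a * p, C a * q, r, by linear_combination hpqr⟩⟩
end

section
/- Let V be a valuation ring. Then every unimodular row of length 3 over V[x] can be completed to an invertible 3×3 matrix over V[x]; consequently, every finitely generated stably free V[x]-module of type arising from such rows is free, i.e., V[x] is a Hermite ring. -/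
open Matrix Polynomial

/-- Over a ring with only finitely many maximal ideals containing `f`, a unimodular row
`(f, g, h)` can be shortened to a unimodular row `(f, g + l * h)`. -/
theorem exists_span_pair_add_mul_eq_top {R : Type*} [CommRing R] {f g h : R}
    (hum : Ideal.span {f, g, h} = ⊤) (hfin : {M : Ideal R | M.IsMaximal ∧ f ∈ M}.Finite) :
    ∃ l : R, Ideal.span {f, g + l * h} = ⊤ := by
  classical
  have : Finite {M : Ideal R | M.IsMaximal ∧ f ∈ M} := hfin
  let I : {M : Ideal R | M.IsMaximal ∧ f ∈ M} → Ideal R := fun M => M.1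
  have hI : Pairwise (Function.onFun IsCoprime I) := fun M N hMN => by
    have hM : M.1.IsMaximal := M.2.1
    have hN : N.1.IsMaximal := N.2.1
    exact Ideal.isCoprime_iff_sup_eq.2 (hM.coprime_of_ne hN fun e => hMN (Subtype.ext e))
  obtain ⟨l, hl⟩ := Ideal.exists_forall_sub_mem_ideal hI fun M => if g ∈ M.1 then 1 else 0
  refine ⟨l, ?_⟩
  by_contra hne
  obtain ⟨M, hM, hle⟩ := Ideal.exists_le_maximal _ hne
  have hf : f ∈ M := hle (Ideal.subset_span (by simp))
  have hs : g + l * h ∈ M := hle (Ideal.subset_span (by simp))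
  have hlM : l - (if g ∈ M then 1 else 0) ∈ M := hl ⟨M, hM, hf⟩
  by_cases hg : g ∈ M
  · rw [if_pos hg] at hlM
    have hh : h ∈ M := by
      have : h = (g + l * h) - g - (l - 1) * h := by ring
      rw [this]
      exact M.sub_mem (M.sub_mem hs hg) (M.mul_mem_right _ hlM)
    apply hM.ne_top
    rw [eq_top_iff, ← hum, Ideal.span_le]
    rintro x (rfl | rfl | rfl) <;> assumption
  · rw [if_neg hg, sub_zero] at hlM
    exact hg ((M.add_mem_iff_left (M.mul_mem_right _ hlM)).1 hs)

/-- Only finitely many primes of `R[X]` containing `f` lie over a prime `p` of `R` which does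
not contain all coefficients of `f`. -/
theorem finite_primes_comap_C_eq {R : Type*} [CommRing R] (p : Ideal R) (f : R[X]) {k : ℕ}
    (hk : f.coeff k ∉ p) :
    {M : Ideal R[X] | M.IsPrime ∧ f ∈ M ∧ M.comap C = p}.Finite := by
  classical
  by_cases hp : p.IsPrime
  swap
  · convert Set.finite_empty
    ext M
    simp only [Set.mem_ofPred_eq, Set.mem_empty_iff_false, iff_false]
    rintro ⟨hM, -, rfl⟩
    exact hp (hM.comap C)
  let ρ : R →+* p.ResidueField := algebraMap R p.ResidueField
  have hf0 : f.map ρ ≠ 0 := fun h0 => hk <| by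
    rw [← Ideal.algebraMap_residueField_eq_zero (I := p)]
    exact (coeff_map ρ k).symm.trans (by rw [h0, coeff_zero])
  refine ((UniqueFactorizationMonoid.normalizedFactors (f.map ρ)).toFinset.finite_toSet.image
    fun q => (Ideal.span {q}).comap (mapRingHom ρ)).subset ?_
  rintro M ⟨hM, hfM, hMp⟩
  let E := FractionRing (R[X] ⧸ M)
  let ψ : R[X] →+* E := (algebraMap (R[X] ⧸ M) E).comp (Ideal.Quotient.mk M)
  have hψ : ∀ g, ψ g = 0 ↔ g ∈ M := fun g => by
    simp only [ψ, RingHom.comp_apply]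
    rw [map_eq_zero_iff _ (IsFractionRing.injective (R[X] ⧸ M) E), Ideal.Quotient.eq_zero_iff_mem]
  have hC : ∀ r, ψ (C r) = 0 ↔ r ∈ p := fun r => by rw [hψ, ← hMp, Ideal.mem_comap]
  have hunit : p.primeCompl ≤ (IsUnit.submonoid E).comap (ψ.comp C) :=
    fun r hr => isUnit_iff_ne_zero.2 fun h => hr ((hC r).1 h)
  let θ : p.ResidueField →+* E :=
    Ideal.ResidueField.lift p (ψ.comp C) (fun r hr => (hC r).2 hr) hunit
  let _ : Algebra p.ResidueField E := θ.toAlgebra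
  have hθ : ∀ g : R[X], aeval (ψ X) (g.map ρ) = ψ g := fun g => by
    have hcomp : θ.comp ρ = ψ.comp C := by
      ext r
      exact Ideal.ResidueField.lift_algebraMap _ _ _ hunit r
    rw [aeval_def, RingHom.algebraMap_toAlgebra, eval₂_map, hcomp, ← hom_eval₂, eval₂_C_X]
  have hroot : aeval (ψ X) (f.map ρ) = 0 := by rw [hθ, hψ]; exact hfM
  have hint : IsIntegral p.ResidueField (ψ X) :=
    (show IsAlgebraic p.ResidueField (ψ X) from ⟨_, hf0, hroot⟩).isIntegral
  refine ⟨minpoly p.ResidueField (ψ X), ?_, ?_⟩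
  · rw [Finset.mem_coe, Multiset.mem_toFinset, Polynomial.mem_normalizedFactors_iff hf0]
    exact ⟨minpoly.irreducible hint, minpoly.monic hint, minpoly.dvd _ _ hroot⟩
  · ext g
    rw [Ideal.mem_comap, Ideal.mem_span_singleton, minpoly.dvd_iff, coe_mapRingHom, hθ, hψ]

/-- If finitely many terms of a valued field sum to zero and are not all zero, then the maximal
value is attained at least twice. -/
theorem Valuation.exists_lt_eq_of_sum_eq_zero {K Γ : Type*} [Field K]
    [LinearOrderedCommGroupWithZero Γ] (w : Valuation K Γ) (n : ℕ) (t : ℕ → K)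
    (hsum : ∑ i ∈ Finset.range n, t i = 0) {k : ℕ} (hk : k ∈ Finset.range n) (htk : t k ≠ 0) :
    ∃ i j, i < j ∧ w (t i) = w (t j) ∧ w (t i) ≠ 0 := by
  obtain ⟨i, hi, hmax⟩ := Finset.exists_max_image (Finset.range n) (fun i => w (t i)) ⟨k, hk⟩
  have hi0 : w (t i) ≠ 0 := fun h0 => by
    have := hmax k hk
    rw [h0, le_zero_iff, w.zero_iff] at this
    exact htk this
  have : ∃ j ∈ Finset.range n \ {i}, w (t i) ≤ w (t j) := by
    by_contra! hcon
    have := w.map_sum_eq_of_lt hi hcon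
    rw [hsum, map_zero] at this
    exact hi0 this.symm
  obtain ⟨j, hj, hij⟩ := this
  rw [Finset.mem_sdiff, Finset.mem_singleton] at hj
  have heq : w (t i) = w (t j) := le_antisymm hij (hmax j hj.1)
  rcases lt_or_gt_of_ne hj.2 with h | h
  · exact ⟨j, i, h, heq.symm, heq ▸ hi0⟩
  · exact ⟨i, j, h, heq, hi0⟩

/-- Let `V` be a valuation ring and let `L` be a field generated as a ring by the image of `V` and
a root `α` of a polynomial `f` with a unit coefficient. If the kernel of `V → L` is not the maximal
ideal, then it is determined by a quotient of two coefficients of `f`. -/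
theorem exists_coeff_dvd_ker_eq {V L : Type*} [CommRing V] [IsLocalRing V] [Field L]
    (hV : ∀ a b : V, a ∣ b ∨ b ∣ a) (φ : V →+* L) (α : L)
    (hsurj : ∀ y, ∃ P : V[X], P.eval₂ φ α = y) {f : V[X]} (hf : f.eval₂ φ α = 0) {k : ℕ}
    (hk : IsUnit (f.coeff k)) {t : V} (ht : ¬ IsUnit t) (hφt : φ t ≠ 0) :
    ∃ i j, i ∈ f.support ∧ j ∈ f.support ∧ f.coeff i ∣ f.coeff j ∧
      ∀ s, f.coeff j = f.coeff i * s → ∀ r, φ r = 0 ↔ ∀ n, ¬ r ∣ s ^ n := by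
  obtain ⟨B, hB, hloc⟩ := IsLocalRing.exists_factor_valuationRing φ
  set w := B.valuation with hw
  have hle : ∀ a, w (φ a) ≤ 1 := fun a => (B.valuation_le_one_iff _).2 (hB a)
  have hlt : ∀ a, ¬ IsUnit a → w (φ a) < 1 := fun a ha => by
    refine lt_of_le_of_ne (hle a) fun h1 => ha ?_
    have : IsUnit (φ.codRestrict B.toSubring hB a) :=
      (B.valuation_eq_one_iff ⟨φ a, hB a⟩).2 h1
    exact hloc.map_nonunit a this
  have hdvd : ∀ a b, a ∣ b → w (φ b) ≤ w (φ a) := by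
    rintro a _ ⟨c, rfl⟩
    rw [map_mul, map_mul]
    exact mul_le_of_le_one_right' (hle c)
  have hα : 1 < w α := by
    by_contra! hα
    obtain ⟨P, hP⟩ := hsurj (φ t)⁻¹
    have h1 : w (φ t)⁻¹ ≤ 1 := by
      rw [← hP, eval₂_eq_sum_range]
      refine w.map_sum_le fun i _ => ?_
      rw [map_mul, map_pow]
      exact mul_le_one' (hle _) (pow_le_one' hα i)
    rw [map_inv₀] at h1
    exact absurd h1 (not_le.2 ((one_lt_inv₀ (zero_lt_iff.2 ((w.ne_zero_iff).2 hφt))).2 (hlt t ht)))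
  have hα0 : w α ≠ 0 := (zero_lt_one.trans hα).ne'
  obtain ⟨i, j, hij, heq, hne⟩ := w.exists_lt_eq_of_sum_eq_zero (f.natDegree + 1)
    (fun i => φ (f.coeff i) * α ^ i) (by rw [← eval₂_eq_sum_range, hf]) (k := k)
    (Finset.mem_range.2 (Nat.lt_succ_of_le (le_natDegree_of_ne_zero hk.ne_zero)))
    (mul_ne_zero (hk.map φ).ne_zero (pow_ne_zero _ ((w.ne_zero_iff).1 hα0)))
  have hnej := heq ▸ hne
  simp only [map_mul, map_pow] at heq hne hnej
  obtain ⟨d, hd, rfl⟩ : ∃ d, d ≠ 0 ∧ j = i + d := ⟨j - i, by omega, by omega⟩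
  have hwi : w (φ (f.coeff i)) ≠ 0 := left_ne_zero_of_mul hne
  have hwj : w (φ (f.coeff (i + d))) ≠ 0 := left_ne_zero_of_mul hnej
  have hval : w (φ (f.coeff i)) = w (φ (f.coeff (i + d))) * w α ^ d := by
    rw [pow_add, mul_comm (w α ^ i), ← mul_assoc] at heq
    exact mul_right_cancel₀ (pow_ne_zero i hα0) heq
  have hαd : 1 < w α ^ d := one_lt_pow₀ hα hd
  have hltij : w (φ (f.coeff (i + d))) < w (φ (f.coeff i)) := by
    rw [hval]
    exact lt_mul_of_one_lt_right (zero_lt_iff.2 hwj) hαd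
  have hmem : ∀ l, w (φ (f.coeff l)) ≠ 0 → l ∈ f.support := fun l hl =>
    mem_support_iff.2 fun h0 => hl (by rw [h0, map_zero, map_zero])
  refine ⟨i, i + d, hmem _ hwi, hmem _ hwj,
    (hV _ _).resolve_right fun h => (hdvd _ _ h).not_gt hltij, fun s hs r => ?_⟩
  have hsα : w (φ s) * w α ^ d = 1 := by
    rw [hs, map_mul, map_mul, mul_assoc] at hval
    exact (mul_left_cancel₀ hwi (by rw [mul_one]; exact hval)).symm
  have hs0 : w (φ s) ≠ 0 := left_ne_zero_of_mul_eq_one hsα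
  have hs1 : w (φ s) < 1 := by
    rw [← hsα]
    exact lt_mul_of_one_lt_right (zero_lt_iff.2 hs0) hαd
  constructor
  · intro hr n hn
    have := hdvd _ _ hn
    rw [hr, map_zero, le_zero_iff, map_pow, map_pow] at this
    exact pow_ne_zero n hs0 this
  · intro hr
    by_contra hr0
    obtain ⟨P, hP⟩ := hsurj (φ r)⁻¹
    have hwr : w (φ r) ≠ 0 := (w.ne_zero_iff).2 hr0
    have h1 : (w (φ r))⁻¹ ≤ (w α ^ d) ^ P.natDegree := by
      rw [← map_inv₀, ← hP, eval₂_eq_sum_range]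
      refine w.map_sum_le fun l hl => ?_
      rw [map_mul, map_pow, ← pow_mul]
      refine (mul_le_of_le_one_left' (hle _)).trans (pow_le_pow_right₀ hα.le ?_)
      exact (Nat.lt_succ_iff.1 (Finset.mem_range.1 hl)).trans
        (Nat.le_mul_of_pos_left _ (Nat.pos_of_ne_zero hd))
    rw [eq_inv_of_mul_eq_one_right hsα, inv_pow,
      inv_le_inv₀ (zero_lt_iff.2 hwr) (zero_lt_iff.2 (pow_ne_zero _ hs0))] at h1
    have h2 := hdvd _ _ ((hV r (s ^ (P.natDegree + 1))).resolve_left (hr _))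
    rw [map_pow, map_pow] at h2
    exact ((h1.trans h2).not_gt) (pow_lt_pow_right_of_lt_one₀ (zero_lt_iff.2 hs0) hs1
      (Nat.lt_succ_self _))

/-- Over a valuation ring `V`, a polynomial with a unit coefficient lies in only finitely many
maximal ideals of `V[X]`. -/
theorem finite_maximal_of_isUnit_coeff {V : Type*} [CommRing V] [IsLocalRing V]
    (hV : ∀ a b : V, a ∣ b ∨ b ∣ a) {f : V[X]} {k : ℕ} (hk : IsUnit (f.coeff k)) :
    {M : Ideal V[X] | M.IsMaximal ∧ f ∈ M}.Finite := by
  classical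
  let Z : V → Set V := fun s => {r | ∀ n, ¬ r ∣ s ^ n}
  let quot : V → V → V := fun a b => if h : a ∣ b then h.choose else 0
  let T : Set (Set V) := insert (IsLocalRing.maximalIdeal V : Set V)
    (Set.image (fun ij : ℕ × ℕ => Z (quot (f.coeff ij.1) (f.coeff ij.2)))
      (f.support ×ˢ f.support : Finset (ℕ × ℕ)))
  have hT : T.Finite := ((Finset.finite_toSet _).image _).insert _
  have hP : {p : Ideal V | (p : Set V) ∈ T ∧ f.coeff k ∉ p}.Finite :=
    (hT.preimage SetLike.coe_injective.injOn).subset fun p hp => hp.1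
  refine (hP.biUnion fun p hp => finite_primes_comap_C_eq p f hp.2).subset ?_
  rintro M ⟨hM, hfM⟩
  have hprime : (M.comap (C : V →+* V[X])).IsPrime := hM.isPrime.comap C
  refine Set.mem_biUnion (x := M.comap C) ⟨?_, fun h => hprime.ne_top
    (Ideal.eq_top_of_isUnit_mem _ h hk)⟩ ⟨hM.isPrime, hfM, rfl⟩
  by_cases hmax : M.comap (C : V →+* V[X]) = IsLocalRing.maximalIdeal V
  · exact Or.inl (congrArg _ hmax)
  right
  obtain ⟨t, ht, htM⟩ := Set.not_subset.1 fun h =>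
    hmax (le_antisymm (IsLocalRing.le_maximalIdeal hprime.ne_top) h)
  let _ : Field (V[X] ⧸ M) := Ideal.Quotient.field M
  have hev : ∀ P : V[X], P.eval₂ ((Ideal.Quotient.mk M).comp C) (Ideal.Quotient.mk M X) =
      Ideal.Quotient.mk M P := fun P => by rw [← hom_eval₂, eval₂_C_X]
  have hker : ∀ r, (Ideal.Quotient.mk M).comp C r = 0 ↔ r ∈ M.comap (C : V →+* V[X]) := fun r => by
    rw [RingHom.comp_apply, Ideal.Quotient.eq_zero_iff_mem, Ideal.mem_comap]
  obtain ⟨i, j, hi, hj, hdvd, hZ⟩ := exists_coeff_dvd_ker_eq hV ((Ideal.Quotient.mk M).comp C)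
    (Ideal.Quotient.mk M X) (fun y => (Ideal.Quotient.mk_surjective y).imp fun P hP => by rw [hev, hP])
    (f := f) (by rw [hev, Ideal.Quotient.eq_zero_iff_mem]; exact hfM) hk (t := t)
    ((IsLocalRing.mem_maximalIdeal t).1 ht) fun h => htM ((hker t).1 h)
  refine ⟨(i, j), by simpa using ⟨mem_support_iff.1 hi, mem_support_iff.1 hj⟩, ?_⟩
  ext r
  rw [SetLike.mem_coe, ← hker, hZ (quot (f.coeff i) (f.coeff j)) ?_]
  · rfl
  · simp only [quot, dif_pos hdvd]
    exact hdvd.choose_spec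

/-- Some entry of a unimodular row over `V[X]`, with `V` local, has a unit coefficient. -/
theorem exists_isUnit_coeff_of_span_range_eq_top {V ι : Type*} [CommRing V] [IsLocalRing V]
    (v : ι → V[X]) (hum : Ideal.span (Set.range v) = ⊤) : ∃ i k, IsUnit ((v i).coeff k) := by
  by_contra! hcon
  have hle : Ideal.span (Set.range v) ≤ (IsLocalRing.maximalIdeal V).map C := by
    rw [Ideal.span_le]
    rintro _ ⟨i, rfl⟩
    exact Ideal.mem_map_C_iff.2 fun k => (IsLocalRing.mem_maximalIdeal _).2 (hcon i k)
  have h1 : (1 : V[X]) ∈ (IsLocalRing.maximalIdeal V).map C := hle (hum ▸ Submodule.mem_top)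
  have := Ideal.mem_map_C_iff.1 h1 0
  rw [coeff_one_zero] at this
  exact (IsLocalRing.mem_maximalIdeal _).1 this isUnit_one

/-- A row `(f, g, h)` such that `(f, g + l * h)` is unimodular can be completed. -/
theorem exists_completion_of_span_pair_eq_top {R : Type*} [CommRing R] {f g h l : R}
    (hl : Ideal.span {f, g + l * h} = ⊤) :
    ∃ A : Matrix (Fin 3) (Fin 3) R, A.det = 1 ∧ A 0 = ![f, g, h] := by
  obtain ⟨a, b, hab⟩ := Ideal.mem_span_pair.1 (hl ▸ Submodule.mem_top : (1 : R) ∈ _)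
  refine ⟨!![f, g, h; -b, a, 0; 0, -l, 1], ?_, rfl⟩
  rw [det_fin_three]
  simp
  linear_combination hab

theorem stmt_6 {V : Type} [CommRing V] (hV : ∀ a b : V, a ∣ b ∨ b ∣ a)
    (v : Fin 3 → V[X]) (hum : IsUnimodular v) :
    ∃ A : Matrix (Fin 3) (Fin 3) V[X], IsUnit A.det ∧ A 0 = v := by
  rcases subsingleton_or_nontrivial V with _ | _
  · exact ⟨fun _ => v, isUnit_of_subsingleton _, rfl⟩
  have : IsLocalRing V := IsLocalRing.of_nonunits_add fun a b ha hb => by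
    rcases hV a b with ⟨c, rfl⟩ | ⟨c, rfl⟩
    · exact fun h => ha (isUnit_of_mul_isUnit_left (y := 1 + c) (by rwa [mul_add, mul_one]))
    · exact fun h => hb (isUnit_of_mul_isUnit_left (y := c + 1) (by rwa [mul_add, mul_one]))
  obtain ⟨i, k, hk⟩ := exists_isUnit_coeff_of_span_range_eq_top v hum
  let σ : Equiv.Perm (Fin 3) := Equiv.swap 0 i
  have hσ : σ 0 = i := Equiv.swap_apply_left 0 i
  have hspan : Ideal.span {v (σ 0), v (σ 1), v (σ 2)} = ⊤ := by
    rw [← show Ideal.span (Set.range v) = ⊤ from hum, ← σ.surjective.range_comp v]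
    congr 1
    ext x
    constructor
    · rintro (rfl | rfl | rfl)
      exacts [⟨0, rfl⟩, ⟨1, rfl⟩, ⟨2, rfl⟩]
    · rintro ⟨j, rfl⟩
      fin_cases j <;> simp
  obtain ⟨l, hl⟩ := exists_span_pair_add_mul_eq_top hspan
    (finite_maximal_of_isUnit_coeff hV (k := k) (by rwa [hσ]))
  obtain ⟨A, hA, hA0⟩ := exists_completion_of_span_pair_eq_top hl
  refine ⟨A.submatrix id σ.symm, ?_, ?_⟩
  · rw [det_permute', hA, mul_one]
    exact σ.sign.isUnit.map (Int.castRingHom V[X])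
  · funext j
    obtain ⟨j, rfl⟩ := σ.surjective j
    rw [submatrix_apply, Equiv.symm_apply_apply, id, hA0]
    fin_cases j <;> rfl
end

section
/- Let V be a valuation ring. Then SL₃(V[x]) = E₃(V[x]), i.e., every 3×3 matrix over V[x] of determinant 1 is a product of elementary matrices. -/
open Matrix Polynomial

section ElementaryGroup

variable {R : Type} [CommRing R]

theorem transvection_mem_Elem {ι : Type} [Fintype ι] [DecidableEq ι] {i j : ι} (h : i ≠ j)
    (a : R) : Matrix.transvection i j a ∈ Elem ι R :=
  Submonoid.subset_closure ⟨i, j, a, h, rfl⟩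

theorem exists_inverse_mem_Elem {ι : Type} [Fintype ι] [DecidableEq ι] {P : Matrix ι ι R}
    (hP : P ∈ Elem ι R) : ∃ Q ∈ Elem ι R, Q * P = 1 ∧ P * Q = 1 := by
  induction hP using Submonoid.closure_induction with
  | mem M hM =>
    obtain ⟨i, j, a, h, rfl⟩ := hM
    exact ⟨_, transvection_mem_Elem h (-a), by simp [Matrix.transvection_mul_transvection_same _ _ h],
      by simp [Matrix.transvection_mul_transvection_same _ _ h]⟩
  | one => exact ⟨1, one_mem _, by simp, by simp⟩
  | mul A B _ _ hA hB =>
    obtain ⟨A', hA', h1, h2⟩ := hA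
    obtain ⟨B', hB', h3, h4⟩ := hB
    refine ⟨B' * A', mul_mem hB' hA', ?_, ?_⟩
    · rw [mul_assoc, ← mul_assoc A', h1, one_mul, h3]
    · rw [mul_assoc, ← mul_assoc B, h4, one_mul, h2]

theorem mul_mem_Elem_iff_left {ι : Type} [Fintype ι] [DecidableEq ι] {P M : Matrix ι ι R}
    (hP : P ∈ Elem ι R) : P * M ∈ Elem ι R ↔ M ∈ Elem ι R := by
  refine ⟨fun h => ?_, mul_mem hP⟩
  obtain ⟨Q, hQ, h1, -⟩ := exists_inverse_mem_Elem hP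
  have := mul_mem hQ h
  rwa [← mul_assoc, h1, one_mul] at this

theorem mul_mem_Elem_iff_right {ι : Type} [Fintype ι] [DecidableEq ι] {P M : Matrix ι ι R}
    (hP : P ∈ Elem ι R) : M * P ∈ Elem ι R ↔ M ∈ Elem ι R := by
  refine ⟨fun h => ?_, fun h => mul_mem h hP⟩
  obtain ⟨Q, hQ, -, h1⟩ := exists_inverse_mem_Elem hP
  have := mul_mem h hQ
  rwa [mul_assoc, h1, mul_one] at this

theorem det_eq_one_of_mem_Elem {ι : Type} [Fintype ι] [DecidableEq ι] {P : Matrix ι ι R}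
    (hP : P ∈ Elem ι R) : P.det = 1 := by
  induction hP using Submonoid.closure_induction with
  | mem M hM =>
    obtain ⟨i, j, a, h, rfl⟩ := hM
    exact Matrix.det_transvection_of_ne i j h a
  | one => simp
  | mul A B _ _ hA hB => rw [Matrix.det_mul, hA, hB, one_mul]

theorem e01_mem (a : R) : !![1, a, 0; 0, 1, 0; 0, 0, 1] ∈ Elem (Fin 3) R := by
  convert transvection_mem_Elem (R := R) (i := (0 : Fin 3)) (j := 1) (by decide) a using 1
  ext i j; fin_cases i <;> fin_cases j <;> simp [Matrix.transvection, Matrix.single]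

theorem e02_mem (a : R) : !![1, 0, a; 0, 1, 0; 0, 0, 1] ∈ Elem (Fin 3) R := by
  convert transvection_mem_Elem (R := R) (i := (0 : Fin 3)) (j := 2) (by decide) a using 1
  ext i j; fin_cases i <;> fin_cases j <;> simp [Matrix.transvection, Matrix.single]

theorem e10_mem (a : R) : !![1, 0, 0; a, 1, 0; 0, 0, 1] ∈ Elem (Fin 3) R := by
  convert transvection_mem_Elem (R := R) (i := (1 : Fin 3)) (j := 0) (by decide) a using 1
  ext i j; fin_cases i <;> fin_cases j <;> simp [Matrix.transvection, Matrix.single]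

theorem e12_mem (a : R) : !![1, 0, 0; 0, 1, a; 0, 0, 1] ∈ Elem (Fin 3) R := by
  convert transvection_mem_Elem (R := R) (i := (1 : Fin 3)) (j := 2) (by decide) a using 1
  ext i j; fin_cases i <;> fin_cases j <;> simp [Matrix.transvection, Matrix.single]

theorem e20_mem (a : R) : !![1, 0, 0; 0, 1, 0; a, 0, 1] ∈ Elem (Fin 3) R := by
  convert transvection_mem_Elem (R := R) (i := (2 : Fin 3)) (j := 0) (by decide) a using 1
  ext i j; fin_cases i <;> fin_cases j <;> simp [Matrix.transvection, Matrix.single]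

theorem e21_mem (a : R) : !![1, 0, 0; 0, 1, 0; 0, a, 1] ∈ Elem (Fin 3) R := by
  convert transvection_mem_Elem (R := R) (i := (2 : Fin 3)) (j := 1) (by decide) a using 1
  ext i j; fin_cases i <;> fin_cases j <;> simp [Matrix.transvection, Matrix.single]

/-- The stabilization of the `2 × 2` matrix with rows `(f, g)` and `(q, p)`. -/
def stab (f g q p : R) : Matrix (Fin 3) (Fin 3) R := !![f, g, 0; q, p, 0; 0, 0, 1]

/-- The Mennicke symbol of `(f, g)` is trivial: every matrix of `SL₂` with first row `(f, g)`
becomes elementary in `SL₃`. -/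
def TrivialSymbol (f g : R) : Prop :=
  ∀ q p, f * p - g * q = 1 → stab f g q p ∈ Elem (Fin 3) R

theorem TrivialSymbol.of_stab_mem {f g q p : R} (h : f * p - g * q = 1)
    (hm : stab f g q p ∈ Elem (Fin 3) R) : TrivialSymbol f g := by
  intro q' p' h'
  have : stab f g q' p' = !![1, 0, 0; q' * p - p' * q, 1, 0; 0, 0, 1] * stab f g q p := by
    ext i j
    fin_cases i <;> fin_cases j <;> simp [stab, Matrix.mul_apply, Fin.sum_univ_three]
    · linear_combination q * h' - q' * h
    · linear_combination p * h' - p' * h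
  rw [this]
  exact mul_mem (e10_mem _) hm

theorem TrivialSymbol.of_add_left {f g : R} (k : R) (h : TrivialSymbol (f + k * g) g) :
    TrivialSymbol f g := by
  intro q p hqp
  have := h (q + k * p) p (by linear_combination hqp)
  rw [← mul_mem_Elem_iff_right (e10_mem k)]
  convert this using 1
  ext i j
  fin_cases i <;> fin_cases j <;> simp [stab, Matrix.mul_apply, Fin.sum_univ_three] <;> ring

theorem TrivialSymbol.of_add_right {f g : R} (k : R) (h : TrivialSymbol f (g + k * f)) :
    TrivialSymbol f g := by
  intro q p hqp
  have := h q (p + k * q) (by linear_combination hqp)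
  rw [← mul_mem_Elem_iff_right (e01_mem k)]
  convert this using 1
  ext i j
  fin_cases i <;> fin_cases j <;> simp [stab, Matrix.mul_apply, Fin.sum_univ_three] <;> ring

theorem trivialSymbol_of_isUnit_right (f : R) {g : R} (hg : IsUnit g) : TrivialSymbol f g := by
  obtain ⟨w, hw⟩ := hg.exists_right_inv
  apply TrivialSymbol.of_add_left (-(f * w))
  have h0 : f + -(f * w) * g = 0 := by linear_combination -f * hw
  rw [h0]
  refine TrivialSymbol.of_stab_mem (q := -w) (p := 0) (by linear_combination hw) ?_
  have := mul_mem (mul_mem (e01_mem g) (e10_mem (-w))) (e01_mem g)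
  convert this using 1
  ext i j
  fin_cases i <;> fin_cases j <;> simp [stab, Matrix.mul_apply, Fin.sum_univ_three]
  all_goals (first | linear_combination hw | linear_combination g * hw | linear_combination -g * hw)

theorem trivialSymbol_of_isUnit_left {f : R} (g : R) (hf : IsUnit f) : TrivialSymbol f g := by
  obtain ⟨w, hw⟩ := hf.exists_right_inv
  apply TrivialSymbol.of_add_right ((1 - g) * w)
  have h0 : g + (1 - g) * w * f = 1 := by linear_combination (1 - g) * hw
  rw [h0]
  exact trivialSymbol_of_isUnit_right _ isUnit_one

/-- Multiplicativity of the Mennicke symbol in matrix form. -/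
theorem stab_mul_eq {a a' b c c' d d' : R} (h : a * d - b * c = 1) (_h' : a' * d' - b * c' = 1) :
    !![1, 0, 0; 0, 1, d' - 1; 0, 0, 1] * (!![1, 0, 0; 0, 1, 0; 0, 1, 1] *
      (!![1, 0, 0; 0, 1, -1; 0, 0, 1] * (stab a b c d * (!![1, 0, 0; 0, 1, 1; 0, 0, 1] *
      (!![1, 0, 0; 0, 1, 0; 0, -1, 1] * (!![1, 0, 0; 0, 1, 1; 0, 0, 1] * (stab a' b c' d' *
      (!![1, 0, 0; 0, 1, -1; 0, 0, 1] * (!![1, 0, 0; 0, 1, 0; 0, 1, 1] *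
      (!![1, 0, 0; 0, 1, a - 1; 0, 0, 1] * (!![1, 0, 0; 0, 1, 0; -(a' * c), 0, 1] *
      !![1, 0, 0; 0, 1, 0; 0, -d, 1]))))))))))) =
    stab (a * a') b (c' + a' * c * d') (d * d') := by
  simp only [stab]
  ext i j
  fin_cases i <;> fin_cases j <;> simp
  all_goals grind

theorem TrivialSymbol.mul {a a' b : R} (ha : TrivialSymbol a b) (ha' : TrivialSymbol a' b) :
    TrivialSymbol (a * a') b := by
  intro q p h
  have h1 : a * (a' * p) - b * q = 1 := by linear_combination h
  have h2 : a' * (a * p) - b * q = 1 := by linear_combination h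
  refine TrivialSymbol.of_stab_mem (q := q + a' * q * (a * p)) (p := a' * p * (a * p)) ?_ ?_ q p h
  · linear_combination (1 + a * a' * p) * h
  · rw [← stab_mul_eq h1 h2]
    refine mul_mem (e12_mem _) (mul_mem (e21_mem _) (mul_mem (e12_mem _) (mul_mem (ha _ _ h1)
      (mul_mem (e12_mem _) (mul_mem (e21_mem _) (mul_mem (e12_mem _) (mul_mem (ha' _ _ h2)
      (mul_mem (e12_mem _) (mul_mem (e21_mem _) (mul_mem (e12_mem _) (mul_mem (e20_mem _)
      (e21_mem _))))))))))))

theorem TrivialSymbol.of_mul {a a' b α β : R} (ha : TrivialSymbol a b) (hab : a * α - b * β = 1)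
    (h : TrivialSymbol (a * a') b) : TrivialSymbol a' b := by
  intro c' d' h'
  have key := stab_mul_eq hab h'
  have hm : stab (a * a') b (c' + a' * β * d') (α * d') ∈ Elem (Fin 3) R :=
    h _ _ (by linear_combination a' * d' * hab + h')
  rw [← key, mul_mem_Elem_iff_left (e12_mem _), mul_mem_Elem_iff_left (e21_mem _),
    mul_mem_Elem_iff_left (e12_mem _), mul_mem_Elem_iff_left (ha _ _ hab),
    mul_mem_Elem_iff_left (e12_mem _), mul_mem_Elem_iff_left (e21_mem _),
    mul_mem_Elem_iff_left (e12_mem _), mul_mem_Elem_iff_right] at hm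
  · exact hm
  · exact mul_mem (e12_mem _) (mul_mem (e21_mem _) (mul_mem (e12_mem _) (mul_mem (e20_mem _)
      (e21_mem _))))

/-- The row `(a, b, c)` can be transformed into `(0, 0, 1)` by elementary column operations. -/
def Reducible (a b c : R) : Prop := RowEquivE ![a, b, c] ![0, 0, 1]

theorem RowEquivE.of_vecMul {v w u : Fin 3 → R} {e : Matrix (Fin 3) (Fin 3) R}
    (he : e ∈ Elem (Fin 3) R) (hw : Matrix.vecMul v e = w) (h : RowEquivE w u) :
    RowEquivE v u := by
  obtain ⟨e', he', h⟩ := h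
  exact ⟨e * e', mul_mem he he', by rw [← Matrix.vecMul_vecMul, hw, h]⟩

theorem Reducible.of_add01 {a b c : R} (k : R) (h : Reducible a (b + k * a) c) :
    Reducible a b c := by
  refine RowEquivE.of_vecMul (e01_mem k) ?_ h
  ext i; fin_cases i <;> simp [Matrix.vecMul, dotProduct, Fin.sum_univ_three]; ring

theorem Reducible.of_add02 {a b c : R} (k : R) (h : Reducible a b (c + k * a)) :
    Reducible a b c := by
  refine RowEquivE.of_vecMul (e02_mem k) ?_ h
  ext i; fin_cases i <;> simp [Matrix.vecMul, dotProduct, Fin.sum_univ_three]; ring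

theorem Reducible.of_add10 {a b c : R} (k : R) (h : Reducible (a + k * b) b c) :
    Reducible a b c := by
  refine RowEquivE.of_vecMul (e10_mem k) ?_ h
  ext i; fin_cases i <;> simp [Matrix.vecMul, dotProduct, Fin.sum_univ_three]; ring

theorem Reducible.of_add12 {a b c : R} (k : R) (h : Reducible a b (c + k * b)) :
    Reducible a b c := by
  refine RowEquivE.of_vecMul (e12_mem k) ?_ h
  ext i; fin_cases i <;> simp [Matrix.vecMul, dotProduct, Fin.sum_univ_three]; ring

theorem Reducible.of_add20 {a b c : R} (k : R) (h : Reducible (a + k * c) b c) :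
    Reducible a b c := by
  refine RowEquivE.of_vecMul (e20_mem k) ?_ h
  ext i; fin_cases i <;> simp [Matrix.vecMul, dotProduct, Fin.sum_univ_three]; ring

theorem Reducible.of_add21 {a b c : R} (k : R) (h : Reducible a (b + k * c) c) :
    Reducible a b c := by
  refine RowEquivE.of_vecMul (e21_mem k) ?_ h
  ext i; fin_cases i <;> simp [Matrix.vecMul, dotProduct, Fin.sum_univ_three]; ring

theorem Reducible.of_swap {a b c : R} (h : Reducible a c (-b)) : Reducible a b c := by
  apply Reducible.of_add21 1
  apply Reducible.of_add12 (-1)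
  apply Reducible.of_add21 1
  convert h using 1 <;> ring

theorem reducible_of_isUnit {a : R} (ha : IsUnit a) (b c : R) : Reducible a b c := by
  obtain ⟨w, hw⟩ := ha.exists_right_inv
  apply Reducible.of_add02 ((1 - c) * w)
  have h1 : c + (1 - c) * w * a = 1 := by linear_combination (1 - c) * hw
  rw [h1]
  apply Reducible.of_add20 (-a)
  apply Reducible.of_add21 (-b)
  exact ⟨1, one_mem _, by simp⟩

/-- A factor that is invertible modulo the first entry can be moved from the third entry of a
row to the second one. -/
theorem Reducible.of_shift {a b c t α τ : R} (ht : a * α + t * τ = 1)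
    (h : Reducible a b (t * c)) : Reducible a (t * b) c := by
  apply Reducible.of_add12 τ
  apply Reducible.of_add02 (α * b)
  apply Reducible.of_add21 (-t)
  apply Reducible.of_add12 τ
  apply Reducible.of_add02 (-(α * c))
  apply Reducible.of_swap
  convert h using 1 <;> grind

theorem Reducible.of_shift' {a b c t α τ : R} (ht : a * α + t * τ = 1)
    (h : Reducible a (t * b) c) : Reducible a b (t * c) := by
  apply Reducible.of_swap
  apply Reducible.of_shift ht
  apply Reducible.of_swap
  apply Reducible.of_swap
  apply Reducible.of_swap
  convert h using 1 <;> ring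

/-- `(a, b, c)` is a unimodular row. -/
def Unimod (a b c : R) : Prop := ∃ p q r, a * p + b * q + c * r = 1

theorem Unimod.shift {a b c t α τ : R} (ht : a * α + t * τ = 1)
    (h : Unimod a (t * b) c) : Unimod a b (t * c) := by
  obtain ⟨p, q, r, h⟩ := h
  exact ⟨p + α * c * r, t * q, τ * r, by linear_combination h + c * r * ht⟩

theorem Unimod.swap {a b c : R} (h : Unimod a b c) : Unimod a c (-b) := by
  obtain ⟨p, q, r, h⟩ := h
  exact ⟨p, r, -q, by linear_combination h⟩

end ElementaryGroup

section Comparable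

variable {V : Type} [CommRing V]

theorem isUnit_or_isUnit_of_isUnit_add (hV : ∀ a b : V, a ∣ b ∨ b ∣ a) {x y : V}
    (h : IsUnit (x + y)) : IsUnit x ∨ IsUnit y := by
  rcases hV x y with hxy | hxy
  · exact Or.inl (isUnit_of_dvd_unit (dvd_add dvd_rfl hxy) h)
  · exact Or.inr (isUnit_of_dvd_unit (dvd_add hxy dvd_rfl) h)

theorem exists_common_factor (hV : ∀ a b : V, a ∣ b ∨ b ∣ a) (n : ℕ) (c : ℕ → V) :
    ∃ s, ∃ e : ℕ → V, (∀ j ≤ n, c j = s * e j) ∧ ∃ i ≤ n, IsUnit (e i) := by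
  induction n with
  | zero => exact ⟨c 0, fun _ => 1, by simp, 0, le_rfl, isUnit_one⟩
  | succ n ih =>
    obtain ⟨s, e, he, i, hi, hu⟩ := ih
    rcases hV s (c (n + 1)) with ⟨d, hd⟩ | ⟨d, hd⟩
    · refine ⟨s, Function.update e (n + 1) d, fun j hj => ?_, i, by omega, ?_⟩
      · rcases Nat.le_succ_iff.mp hj with h | rfl
        · rw [Function.update_of_ne (by omega), he j h]
        · simpa using hd
      · rwa [Function.update_of_ne (by omega)]
    · refine ⟨c (n + 1), Function.update (fun j => d * e j) (n + 1) 1, fun j hj => ?_,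
        n + 1, le_rfl, by simp⟩
      rcases Nat.le_succ_iff.mp hj with h | rfl
      · rw [Function.update_of_ne (by omega), he j h, hd, mul_assoc]
      · simp

/-- Every polynomial is a constant multiple of a polynomial with a unit coefficient. -/
theorem exists_eq_C_mul_primitive (hV : ∀ a b : V, a ∣ b ∨ b ∣ a) {n : ℕ} {g : V[X]}
    (hg : g.natDegree ≤ n) :
    ∃ s, ∃ g' : V[X], g = C s * g' ∧ g'.natDegree ≤ n ∧ ∃ i ≤ n, IsUnit (g'.coeff i) := by
  obtain ⟨s, e, he, i, hi, hu⟩ := exists_common_factor hV n g.coeff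
  have hc : ∀ k, (∑ j ∈ Finset.range (n + 1), monomial j (e j)).coeff k =
      if k ≤ n then e k else 0 := by
    intro k
    simp [coeff_monomial]
  refine ⟨s, ∑ j ∈ Finset.range (n + 1), monomial j (e j), ?_, ?_, i, hi, ?_⟩
  · ext k
    rw [coeff_C_mul, hc]
    split_ifs with hk
    · exact he k hk
    · rw [mul_zero, coeff_eq_zero_of_natDegree_lt (by omega)]
  · rw [natDegree_le_iff_coeff_eq_zero]
    intro k hk
    rw [hc, if_neg (by omega)]
  · rwa [hc, if_pos hi]

theorem exists_X_bezout {f : V[X]} (hf : IsUnit (f.coeff 0)) :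
    ∃ α τ : V[X], f * α + X * τ = 1 := by
  obtain ⟨w, hw⟩ := hf.exists_right_inv
  refine ⟨C w, -(f.divX * C w), ?_⟩
  have h := X_mul_divX_add f
  have hw' : (C (f.coeff 0) * C w : V[X]) = 1 := by rw [← C_mul, hw, C_1]
  linear_combination (-C w) * h + hw'

/-- If a property of polynomials modulo `f` is stable under multiplication by `X`, and `f` has
invertible constant term, then it is enough to check it in degrees less than the degree of `f`. -/
theorem of_natDegree_lt {f : V[X]} {n : ℕ} (hfn : f.natDegree ≤ n) (hn : 0 < n)
    (hf : IsUnit (f.coeff 0)) {P : V[X] → Prop} (hadd : ∀ g k, P (g + k * f) → P g)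
    (hX : ∀ g, P g → P (X * g)) (hlow : ∀ g, g.natDegree < n → P g) (g : V[X]) : P g := by
  obtain ⟨w, hw⟩ := hf.exists_right_inv
  induction hd : g.natDegree using Nat.strong_induction_on generalizing g with
  | _ d ih =>
    by_cases hgn : g.natDegree < n
    · exact hlow g hgn
    · set g' := g + C (-(g.coeff 0 * w)) * f with hg'
      have h0 : g'.coeff 0 = 0 := by
        simp only [hg', coeff_add, coeff_C_mul]
        linear_combination -g.coeff 0 * hw
      have hdeg : g'.natDegree ≤ d := by
        refine natDegree_add_le_of_degree_le hd.le ((natDegree_C_mul_le _ _).trans (by omega))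
      have hX' : X * g'.divX = g' := by
        have := X_mul_divX_add g'
        rwa [h0, C_0, add_zero] at this
      refine hadd g (C (-(g.coeff 0 * w))) ?_
      rw [← hg', ← hX']
      refine hX _ (ih _ ?_ _ rfl)
      rw [natDegree_divX_eq_natDegree_tsub_one]
      omega

/-- A property of polynomials modulo `f` that is invariant under multiplication by `X` holds for
each polynomial of low degree with a unit coefficient, as soon as it holds whenever the degree of
`f` can be lowered. -/
theorem of_isUnit_coeff (hV : ∀ a b : V, a ∣ b ∨ b ∣ a) {f : V[X]} {n : ℕ}
    (hfn : f.natDegree ≤ n + 1) {P : V[X] → Prop} (hadd : ∀ g k, P (g + k * f) → P g)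
    (hX : ∀ g, P (X * g) → P g) (hlow : ∀ g d, (f + d * (X * g)).natDegree ≤ n → P g)
    {g : V[X]} (hg : g.natDegree ≤ n) {i : ℕ} (hi : i ≤ n) (hu : IsUnit (g.coeff i)) : P g := by
  obtain ⟨j, hj⟩ := Nat.exists_eq_add_of_le hi
  have key : ∀ h : V[X], h.natDegree ≤ n + 1 → h.coeff (n + 1) = 0 → h.natDegree ≤ n := by
    intro h h1 h2
    rw [natDegree_le_iff_coeff_eq_zero] at h1 ⊢
    intro k hk
    rcases Nat.lt_or_ge (n + 1) k with h3 | h3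
    · exact h1 k h3
    · rwa [show k = n + 1 by omega]
  have hXdeg : ∀ g : V[X], g.natDegree ≤ n → (X * g).natDegree ≤ n + 1 := fun g hg =>
    (natDegree_mul_le_of_le natDegree_X_le hg).trans (by omega)
  have hdvd : ∀ g : V[X], g.natDegree ≤ n → g.coeff n ∣ f.coeff (n + 1) → P g := by
    rintro g hg ⟨d, hd⟩
    refine hlow g (C (-d)) (key _ ?_ ?_)
    · exact natDegree_add_le_of_degree_le hfn ((natDegree_C_mul_le _ _).trans (hXdeg g hg))
    · rw [coeff_add, coeff_C_mul, coeff_X_mul, hd]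
      ring
  induction j generalizing g i with
  | zero =>
    obtain rfl : n = i := by omega
    exact hdvd g hg hu.dvd
  | succ j ih =>
    by_cases hdiv : g.coeff n ∣ f.coeff (n + 1)
    · exact hdvd g hg hdiv
    obtain ⟨c, hc⟩ := (hV (g.coeff n) (f.coeff (n + 1))).resolve_left hdiv
    have hcu : ¬ IsUnit c := fun h => hdiv (by rw [hc]; exact (h.mul_right_dvd).mpr dvd_rfl)
    refine hX g (hadd _ (C (-c)) (ih (i := i + 1) ?_ (by omega) ?_ (by omega)))
    · refine key _ ?_ ?_
      · exact natDegree_add_le_of_degree_le (hXdeg g hg) ((natDegree_C_mul_le _ _).trans hfn)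
      · rw [coeff_add, coeff_C_mul, coeff_X_mul, hc]
        ring
    · rw [coeff_add, coeff_C_mul, coeff_X_mul]
      have : IsUnit ((g.coeff i + -c * f.coeff (i + 1)) + c * f.coeff (i + 1)) := by
        simpa using hu
      exact (isUnit_or_isUnit_of_isUnit_add hV this).resolve_right
        fun h => hcu (isUnit_of_mul_isUnit_left h)

theorem isNilpotent_coeff_of_bezout {f α β : V[X]} {s : V} (h : C s * α - f * β = 1) {i : ℕ}
    (hi : i ≠ 0) : ∃ k, s ∣ f.coeff i ^ k := by
  have hu : IsUnit (f.map (Ideal.Quotient.mk (Ideal.span {s}))) := by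
    have h1 := congrArg (Polynomial.map (Ideal.Quotient.mk (Ideal.span {s}))) h
    have hs : Ideal.Quotient.mk (Ideal.span {s}) s = 0 :=
      Ideal.Quotient.eq_zero_iff_mem.mpr (Ideal.mem_span_singleton_self s)
    simp only [Polynomial.map_sub, Polynomial.map_mul, map_C, hs, C_0, zero_mul,
      Polynomial.map_one, zero_sub] at h1
    exact IsUnit.of_mul_eq_one (-β.map _) (by rw [mul_neg, h1])
  obtain ⟨k, hk⟩ := (Polynomial.isUnit_iff_coeff_isUnit_isNilpotent.mp hu).2 i hi
  refine ⟨k, ?_⟩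
  rwa [coeff_map, ← map_pow, Ideal.Quotient.eq_zero_iff_mem, Ideal.mem_span_singleton] at hk

theorem trivialSymbol_C_of_dvd_pow (hV : ∀ a b : V, a ∣ b ∨ b ∣ a) {u t : V} (hu : IsUnit u)
    (F : V[X]) (k : ℕ) (s : V) (hs : s ∣ t ^ k) :
    TrivialSymbol (C s) (C u + C t * F) := by
  have hbase : ∀ s, s ∣ t → TrivialSymbol (C s) (C u + C t * F) := by
    rintro s ⟨d, rfl⟩
    apply TrivialSymbol.of_add_right (-(C d * F))
    have : C u + C (s * d) * F + -(C d * F) * C s = C u := by rw [C_mul]; ring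
    rw [this]
    exact trivialSymbol_of_isUnit_right _ (isUnit_C.mpr hu)
  induction k generalizing s with
  | zero => exact trivialSymbol_of_isUnit_left _ (isUnit_C.mpr (isUnit_of_dvd_one (by simpa using hs)))
  | succ k ih =>
    rcases hV s t with h | ⟨s', rfl⟩
    · exact hbase s h
    have hmul : s' ∣ t ^ k → TrivialSymbol (C (t * s')) (C u + C t * F) := fun h => by
      rw [C_mul]
      exact (hbase t dvd_rfl).mul (ih s' h)
    rcases hV s' (t ^ k) with h | ⟨z, rfl⟩
    · exact hmul h
    obtain ⟨w, hw⟩ := hs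
    have h1 : IsUnit (z * w + (1 - z * w)) := by simp
    rcases isUnit_or_isUnit_of_isUnit_add hV h1 with h | h
    · exact hmul ((isUnit_of_mul_isUnit_left h).mul_right_dvd.mpr dvd_rfl)
    · have h0 : t ^ (k + 1) = 0 := by
        rw [← h.mul_left_eq_zero]
        linear_combination hw
      have h2 : t * (t ^ k * z) = 0 := by linear_combination z * h0
      rw [h2]
      refine trivialSymbol_of_isUnit_right _ ?_
      refine IsNilpotent.isUnit_add_left_of_commute ?_ (isUnit_C.mpr hu) (Commute.all _ _)
      exact ⟨k + 1, by rw [mul_pow, ← C_pow, h0, C_0, zero_mul]⟩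

theorem trivialSymbol_C (hV : ∀ a b : V, a ∣ b ∨ b ∣ a) {f : V[X]} (hf : IsUnit (f.coeff 0))
    (s : V) : TrivialSymbol (C s) f := by
  intro q p h
  obtain ⟨t, F, hF, -, i, -, hi⟩ := exists_eq_C_mul_primitive hV (le_refl f.divX.natDegree)
  obtain ⟨k, hk⟩ := isNilpotent_coeff_of_bezout h (Nat.succ_ne_zero i)
  have hf' : f = C (f.coeff 0) + C t * (X * F) := by
    linear_combination -(X_mul_divX_add f) + X * hF
  have hc : f.coeff (i + 1) = t * F.coeff i := by rw [← coeff_divX, hF, coeff_C_mul]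
  rw [hc, mul_pow, (hi.pow k).dvd_mul_right] at hk
  have := trivialSymbol_C_of_dvd_pow hV hf (X * F) k s hk
  rw [← hf'] at this
  exact this q p h

theorem trivialSymbol_X {f : V[X]} (hf : IsUnit (f.coeff 0)) : TrivialSymbol X f := by
  apply TrivialSymbol.of_add_right (-f.divX)
  have h : f + -f.divX * X = C (f.coeff 0) := by linear_combination -(X_mul_divX_add f)
  rw [h]
  exact trivialSymbol_of_isUnit_right _ (isUnit_C.mpr hf)

theorem trivialSymbol_of_isUnit_coeff_zero (hV : ∀ a b : V, a ∣ b ∨ b ∣ a) (n : ℕ) {f : V[X]}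
    (hfn : f.natDegree ≤ n) (hf : IsUnit (f.coeff 0)) (g : V[X]) : TrivialSymbol g f := by
  induction n generalizing f g with
  | zero =>
    rw [eq_C_of_natDegree_le_zero hfn]
    exact trivialSymbol_of_isUnit_right _ (isUnit_C.mpr hf)
  | succ n ih =>
    obtain ⟨α, τ, hX⟩ := exists_X_bezout hf
    have hadd : ∀ g k, TrivialSymbol (g + k * f) f → TrivialSymbol g f :=
      fun g k h => h.of_add_left k
    refine of_natDegree_lt (P := fun g => TrivialSymbol g f) hfn n.succ_pos hf hadd
      (fun g h => (trivialSymbol_X hf).mul h) ?_ g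
    intro g hg
    obtain ⟨s, g', rfl, hg', i, hi, hu⟩ := exists_eq_C_mul_primitive hV (Nat.lt_succ_iff.mp hg)
    refine (trivialSymbol_C hV hf s).mul ?_
    refine of_isUnit_coeff hV (P := fun g => TrivialSymbol g f) hfn hadd ?_ ?_ hg' hi hu
    · intro g h
      exact TrivialSymbol.of_mul (α := τ) (β := -α) (trivialSymbol_X hf)
        (by linear_combination hX) h
    · intro g d hd
      refine TrivialSymbol.of_add_right (d * X) ?_
      rw [mul_assoc]
      exact ih hd (by simpa using hf) g

theorem trivialSymbol_of_comparable (hV : ∀ a b : V, a ∣ b ∨ b ∣ a) (f g : V[X]) :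
    TrivialSymbol f g := by
  intro q p h
  have h0 : f.coeff 0 * p.coeff 0 + -(g.coeff 0 * q.coeff 0) = 1 := by
    have := congrArg (fun r => coeff r 0) h
    simpa [mul_coeff_zero, sub_eq_add_neg] using this
  rcases isUnit_or_isUnit_of_isUnit_add hV (h0 ▸ isUnit_one) with hu | hu
  · obtain ⟨w, hw⟩ := (isUnit_of_mul_isUnit_left hu).exists_right_inv
    refine TrivialSymbol.of_add_right (C ((1 - g.coeff 0) * w)) ?_ q p h
    refine trivialSymbol_of_isUnit_coeff_zero hV _ le_rfl ?_ f
    rw [coeff_add, coeff_C_mul]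
    convert isUnit_one (M := V) using 1
    linear_combination (1 - g.coeff 0) * hw
  · exact trivialSymbol_of_isUnit_coeff_zero hV _ le_rfl
      (isUnit_of_mul_isUnit_left (IsUnit.neg_iff _ |>.mp hu)) f q p h

theorem reducible_of_isUnit_coeff_zero (hV : ∀ a b : V, a ∣ b ∨ b ∣ a) (n : ℕ) {f : V[X]}
    (hfn : f.natDegree ≤ n) (hf : IsUnit (f.coeff 0)) (g h : V[X]) (hu : Unimod f g h) :
    Reducible f g h := by
  induction n generalizing f g h with
  | zero =>
    rw [eq_C_of_natDegree_le_zero hfn]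
    exact reducible_of_isUnit (isUnit_C.mpr hf) _ _
  | succ n ih =>
    obtain ⟨α, τ, hX⟩ := exists_X_bezout hf
    let P : V[X] → Prop := fun g => ∀ h, Unimod f g h → Reducible f g h
    have hPadd : ∀ g k, P (g + k * f) → P g := by
      rintro g k hP h ⟨p, q, r, e⟩
      exact (hP h ⟨p - k * q, q, r, by linear_combination e⟩).of_add01 k
    have hPX : ∀ g, P g → P (X * g) := fun g hP h hu => (hP _ (hu.shift hX)).of_shift hX
    have hPX' : ∀ g, P (X * g) → P g := by
      rintro g hP h ⟨p, q, r, e⟩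
      refine Reducible.of_add02 (-(α * h)) ?_
      rw [show h + -(α * h) * f = X * (τ * h) by linear_combination -h * hX]
      refine Reducible.of_shift' hX (hP _ ⟨p + α * (g * q + h * r), τ * q, X * r, ?_⟩)
      linear_combination e + (g * q + h * r) * hX
    have hPunit : ∀ g : V[X], g.natDegree ≤ n → (∃ i ≤ n, IsUnit (g.coeff i)) → P g := by
      rintro g hg ⟨i, hi, hgi⟩
      refine of_isUnit_coeff hV hfn hPadd hPX' ?_ hg hi hgi
      rintro g d hd h ⟨p, q, r, e⟩
      refine Reducible.of_add10 (d * X) ?_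
      rw [mul_assoc]
      exact ih hd (by simpa using hf) g h ⟨p, q - d * X * p, r, by linear_combination e⟩
    let Q : V[X] → Prop := fun h =>
      ∀ g, P g → ∀ s : V, Unimod f (C s * g) h → Reducible f (C s * g) h
    have hQ : ∀ h, Q h := by
      refine of_natDegree_lt hfn n.succ_pos hf ?_ ?_ ?_
      · rintro h k hQ g hP s ⟨p, q, r, e⟩
        exact (hQ g hP s ⟨p - k * r, q, r, by linear_combination e⟩).of_add02 k
      · intro h hQ g hP s hu
        refine Reducible.of_shift' hX ?_
        rw [mul_left_comm]
        refine hQ _ (hPX g hP) s ?_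
        obtain ⟨p, q, r, e⟩ := hu
        refine ⟨p + α * (C s * g * q), τ * q, X * r, ?_⟩
        linear_combination e + C s * g * q * hX
      · intro h hh g hP s hu
        obtain ⟨r, h', rfl, hh', hi⟩ := exists_eq_C_mul_primitive hV (Nat.lt_succ_iff.mp hh)
        have hPh := hPunit h' hh' hi
        rcases hV s r with ⟨d, rfl⟩ | ⟨d, rfl⟩
        · obtain ⟨p, q, w, e⟩ := id hu
          have hs : f * p + C s * (g * q + C d * h' * w) = 1 := by
            rw [C_mul] at e
            linear_combination e
          exact (hP _ (hu.shift hs)).of_shift hs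
        · obtain ⟨p, q, w, e⟩ := id hu
          have hr : f * p + C r * (C d * g * q + h' * w) = 1 := by
            rw [C_mul] at e
            linear_combination e
          refine Reducible.of_shift' hr (Reducible.of_swap (hPh _ (Unimod.swap ?_)))
          refine ⟨p + p * (C r * C d * g * q), (C d * g * q + h' * w) * q, C r * w, ?_⟩
          rw [C_mul] at e ⊢
          linear_combination e + C r * C d * g * q * hr
    refine of_natDegree_lt (P := P) hfn n.succ_pos hf hPadd hPX ?_ g h hu
    intro g hg
    obtain ⟨s, g', rfl, hg', hi⟩ := exists_eq_C_mul_primitive hV (Nat.lt_succ_iff.mp hg)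
    exact fun h => hQ h g' (hPunit g' hg' hi) s

theorem reducible_of_unimod (hV : ∀ a b : V, a ∣ b ∨ b ∣ a) {f g h : V[X]}
    (hu : Unimod f g h) : Reducible f g h := by
  obtain ⟨p, q, r, e⟩ := hu
  have h0 : f.coeff 0 * p.coeff 0 + g.coeff 0 * q.coeff 0 + h.coeff 0 * r.coeff 0 = 1 := by
    have := congrArg (fun r => coeff r 0) e
    simpa [mul_coeff_zero] using this
  have hone : ∀ x w : V, x * w = 1 → ∀ y : V, IsUnit (y + (1 - y) * w * x) := by
    intro x w hw y
    convert isUnit_one (M := V) using 1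
    linear_combination (1 - y) * hw
  rcases isUnit_or_isUnit_of_isUnit_add hV (h0 ▸ isUnit_one) with hu | hu
  · rcases isUnit_or_isUnit_of_isUnit_add hV hu with hu | hu
    · exact reducible_of_isUnit_coeff_zero hV _ le_rfl (isUnit_of_mul_isUnit_left hu) g h
        ⟨p, q, r, e⟩
    · obtain ⟨w, hw⟩ := (isUnit_of_mul_isUnit_left hu).exists_right_inv
      refine Reducible.of_add10 (C ((1 - f.coeff 0) * w)) ?_
      refine reducible_of_isUnit_coeff_zero hV _ le_rfl ?_ g h
        ⟨p, q - C ((1 - f.coeff 0) * w) * p, r, by linear_combination e⟩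
      rw [coeff_add, coeff_C_mul]
      exact hone _ w hw _
  · obtain ⟨w, hw⟩ := (isUnit_of_mul_isUnit_left hu).exists_right_inv
    refine Reducible.of_add20 (C ((1 - f.coeff 0) * w)) ?_
    refine reducible_of_isUnit_coeff_zero hV _ le_rfl ?_ g h
      ⟨p, q, r - C ((1 - f.coeff 0) * w) * p, by linear_combination e⟩
    rw [coeff_add, coeff_C_mul]
    exact hone _ w hw _

end Comparable

theorem stmt_13 {V : Type} [CommRing V] (hV : ∀ a b : V, a ∣ b ∨ b ∣ a)
    (M : Matrix (Fin 3) (Fin 3) V[X]) :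
    M.det = 1 ↔ M ∈ Elem (Fin 3) V[X] := by
  refine ⟨fun hM => ?_, det_eq_one_of_mem_Elem⟩
  have hu : Unimod (M 2 0) (M 2 1) (M 2 2) := by
    refine ⟨M 0 1 * M 1 2 - M 0 2 * M 1 1, M 0 2 * M 1 0 - M 0 0 * M 1 2,
      M 0 0 * M 1 1 - M 0 1 * M 1 0, ?_⟩
    rw [← hM, Matrix.det_fin_three]
    ring
  obtain ⟨e, he, hrow⟩ := reducible_of_unimod hV hu
  rw [← mul_mem_Elem_iff_right he]
  set N := M * e with hN
  have hNdet : N.det = 1 := by rw [hN, Matrix.det_mul, hM, det_eq_one_of_mem_Elem he, one_mul]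
  have hN2 : N 2 = ![0, 0, 1] := by
    rw [← hrow, hN, Matrix.mul_apply_eq_vecMul]
    congr 1
    ext i
    fin_cases i <;> rfl
  have h20 : N 2 0 = 0 := by rw [hN2]; rfl
  have h21 : N 2 1 = 0 := by rw [hN2]; rfl
  have h22 : N 2 2 = 1 := by rw [hN2]; rfl
  rw [← mul_mem_Elem_iff_left (mul_mem (e02_mem (-N 0 2)) (e12_mem (-N 1 2)))]
  convert trivialSymbol_of_comparable hV (N 0 0) (N 0 1) (N 1 0) (N 1 1) ?_ using 1
  · ext1 i j
    fin_cases i <;> fin_cases j <;>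
      simp [stab, Matrix.mul_apply, Fin.sum_univ_three, h20, h21, h22]
  · rw [← hNdet, Matrix.det_fin_three, h20, h21, h22]
    ring
end
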